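/- Let P ≥ 2 and 2 ≤ R ≤ P, and suppose C₁ > 0 satisfies ∫₀¹ |h(α;P,R)|¹⁰ dα ≤ C₁·P^{6+Δ₁₀}. Let T ≥ 1, let 𝒵 = {n ∈ ℤ : |n| ≤ P⁹ and T < |ψ(n)| ≤ 2T}, let Z = card(𝒵), let ω_n = 1 if ψ(n) > 0 and ω_n = −1 if ψ(n) < 0, and put K(α) = Σ_{n∈𝒵} ω_n e(−nα). Suppose further that ε > 0 and C₃ > 0 satisfy ∫₀¹ |h(α;P,R)⁴ K(α)²| dα ≤ C₃·(P³Z + P^{2+ε}Z^{3/2}). Then Z ≤ C·( P^{9 + Δ₁₀}·T^{−2} + P^{16 + 2Δ₁₀ + ε}·T^{−4} ) for a constant C depending at most on C₁, C₃ and ε. -/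

import Mathlib

open scoped Real
open Filter MeasureTheory

noncomputable section

/-- `e(z) = exp(2πiz)`. -/
def e (z : ℝ) : ℂ := Complex.exp (2 * Real.pi * Complex.I * z)

/-- The set `𝒜(P,R)` of `R`-smooth positive integers not exceeding `P`. -/
def smoothA (P R : ℝ) : Finset ℕ :=
  (Finset.Icc 1 ⌊P⌋₊).filter (fun n => ∀ p ∈ n.primeFactors, (p : ℝ) ≤ R)

/-- The smooth Weyl sum `h(α; P, R)`. -/
def h (P R α : ℝ) : ℂ := ∑ x ∈ smoothA P R, e (α * (x : ℝ) ^ 4)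

/-- `Δ₇ = 0.849408`. -/
def Δ₇ : ℝ := 0.849408

/-- `Δ₁₀ = 0.213431`. -/
def Δ₁₀ : ℝ := 0.213431

/-- The Fourier coefficient `ψ(n) = ∫₀¹ |h(α)|⁷ e(-nα) dα`. -/
def ψ (P R : ℝ) (n : ℤ) : ℂ :=
  ∫ α in (0:ℝ)..1, (‖h P R α‖ : ℂ) ^ 7 * e (-(n : ℝ) * α)

/-- The set `𝒵 = {n ∈ ℤ : |n| ≤ P⁹, T < |ψ(n)| ≤ 2T}`. -/
def Zset (P R T : ℝ) : Finset ℤ :=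
  (Finset.Icc (-⌊P ^ 9⌋) ⌊P ^ 9⌋).filter
    (fun n => T < ‖ψ P R n‖ ∧ ‖ψ P R n‖ ≤ 2 * T)

/-- The exponential sum `K(α) = Σ_{n∈𝒵} ω_n e(-nα)`, where `ω_n = sgn ψ(n)`. -/
def K (P R T : ℝ) (α : ℝ) : ℂ :=
  ∑ n ∈ Zset P R T, (if 0 < (ψ P R n).re then (1 : ℂ) else -1) * e (-(n : ℝ) * α)


theorem card_divisors_le_rpow {δ : ℝ} (hδ : 0 < δ) :
    ∃ C : ℝ, 1 ≤ C ∧ ∀ n : ℕ, n ≠ 0 → (n.divisors.card : ℝ) ≤ C * (n : ℝ) ^ δ := by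
  have hlog : 0 < Real.log 2 := Real.log_pos one_lt_two
  set B : ℝ := 1 + 1 / (δ * Real.log 2) with hB
  have hB1 : 1 ≤ B := by rw [hB]; have : 0 ≤ 1 / (δ * Real.log 2) := by positivity
                         linarith
  set M : ℕ := ⌈(2 : ℝ) ^ (1 / δ)⌉₊ with hM
  refine ⟨B ^ M, one_le_pow₀ hB1, fun n hn => ?_⟩
  have key : ∀ p ∈ n.primeFactors, ((n.factorization p : ℝ) + 1) ≤
      (if p < M then B else 1) * ((p : ℝ) ^ n.factorization p) ^ δ := by
    intro p hp
    have hp2 : (2 : ℝ) ≤ p := by exact_mod_cast (Nat.prime_of_mem_primeFactors hp).two_le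
    set v := n.factorization p
    have hcomm : ((p : ℝ) ^ v) ^ δ = ((p : ℝ) ^ δ) ^ v := by
      rw [← Real.rpow_natCast, ← Real.rpow_natCast, ← Real.rpow_mul (by positivity),
        ← Real.rpow_mul (by positivity), mul_comm]
    rw [hcomm]
    split_ifs with h
    · have h1 : (2 : ℝ) ^ δ ≤ (p : ℝ) ^ δ := Real.rpow_le_rpow (by norm_num) hp2 hδ.le
      have h2 : 1 + δ * Real.log 2 ≤ (2 : ℝ) ^ δ := by
        rw [Real.rpow_def_of_pos two_pos]
        linarith [Real.add_one_le_exp (Real.log 2 * δ)]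
      have h3 : 1 + v * (δ * Real.log 2) ≤ ((p : ℝ) ^ δ) ^ v :=
        (one_add_mul_le_pow (by nlinarith [mul_pos hδ hlog]) v).trans
          (pow_le_pow_left₀ (by positivity) (h2.trans h1) v)
      calc (v : ℝ) + 1 ≤ B * (1 + v * (δ * Real.log 2)) := by
            have e1 : 1 / (δ * Real.log 2) * (v * (δ * Real.log 2)) = v := by
              field_simp
            have e2 : 0 ≤ v * (δ * Real.log 2) := by positivity
            have e3 : 0 ≤ 1 / (δ * Real.log 2) := by positivity
            rw [hB]; nlinarith
        _ ≤ _ := by gcongr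
    · have hMp : (2 : ℝ) ^ (1 / δ) ≤ p :=
        (Nat.le_ceil _).trans (by exact_mod_cast not_lt.mp h)
      have h1 : (2 : ℝ) ≤ (p : ℝ) ^ δ := by
        calc (2 : ℝ) = ((2 : ℝ) ^ (1 / δ)) ^ δ := by
              rw [← Real.rpow_mul (by norm_num), one_div_mul_cancel hδ.ne', Real.rpow_one]
          _ ≤ _ := Real.rpow_le_rpow (by positivity) hMp hδ.le
      rw [one_mul]
      calc (v : ℝ) + 1 ≤ 2 ^ v := by exact_mod_cast Nat.lt_two_pow_self
        _ ≤ _ := pow_le_pow_left₀ (by norm_num) h1 v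
  have hconst : ∏ p ∈ n.primeFactors, (if p < M then B else 1) ≤ B ^ M := by
    rw [← Finset.prod_filter, Finset.prod_const]
    refine pow_le_pow_right₀ hB1 ?_
    calc _ ≤ (Finset.range M).card := Finset.card_le_card fun p hp => by
          simpa using (Finset.mem_filter.mp hp).2
      _ = M := Finset.card_range M
  have hprod : ∏ p ∈ n.primeFactors, ((p : ℝ) ^ n.factorization p) ^ δ = (n : ℝ) ^ δ := by
    rw [Real.finsetProd_rpow _ _ (fun p _ => by positivity)]
    congr 1
    conv_rhs => rw [← Nat.prod_factorization_pow_eq_self hn]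
    simp [Finsupp.prod]
  rw [Nat.card_divisors hn]
  push_cast
  calc _ ≤ ∏ p ∈ n.primeFactors,
        ((if p < M then B else 1) * ((p : ℝ) ^ n.factorization p) ^ δ) :=
        Finset.prod_le_prod (fun p _ => by positivity) key
    _ ≤ _ := by
        rw [Finset.prod_mul_distrib, hprod]
        gcongr

/-- Cauchy–Schwarz over the fibres of `g` inside the fibres of `f`. -/
theorem card_filter_eq_le_card_mul {ι κ κ' : Type*} [DecidableEq κ] [DecidableEq κ']
    (s : Finset ι) (f : ι → κ) (g : ι → κ') (t : Finset κ') (hg : ∀ i ∈ s, g i ∈ t) :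
    ((s ×ˢ s).filter fun p => f p.1 = f p.2).card ≤
      t.card * ((s ×ˢ s).filter fun p => f p.1 = f p.2 ∧ g p.1 = g p.2).card := by
  have fib : ∀ k, (((s ×ˢ s).filter fun p => f p.1 = f p.2).filter fun p => f p.1 = k).card =
      (s.filter fun i => f i = k).card ^ 2 := by
    intro k
    rw [sq, ← Finset.card_product]
    congr 1
    ext ⟨a, b⟩
    simp only [Finset.mem_filter, Finset.mem_product]
    grind
  have fib' : ∀ k l, ((((s ×ˢ s).filter fun p => f p.1 = f p.2 ∧ g p.1 = g p.2).filter
      fun p => f p.1 = k).filter fun p => g p.1 = l).card =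
      ((s.filter fun i => f i = k).filter fun i => g i = l).card ^ 2 := by
    intro k l
    rw [sq, ← Finset.card_product]
    congr 1
    ext ⟨a, b⟩
    simp only [Finset.mem_filter, Finset.mem_product]
    grind
  rw [Finset.card_eq_sum_card_fiberwise (f := fun p => f p.1) (t := s.image f)
      (fun p hp => by simp at hp ⊢; exact ⟨p.1, hp.1.1, rfl⟩),
    Finset.card_eq_sum_card_fiberwise (f := fun p => f p.1) (t := s.image f)
      (s := (s ×ˢ s).filter fun p => f p.1 = f p.2 ∧ g p.1 = g p.2)
      (fun p hp => by simp at hp ⊢; exact ⟨p.1, hp.1.1, rfl⟩), Finset.mul_sum]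
  refine Finset.sum_le_sum fun k _ => ?_
  rw [fib, Finset.card_eq_sum_card_fiberwise (f := g) (t := t)
      (s := s.filter fun i => f i = k) (fun p hp => by simp at hp; exact hg _ hp.1),
    Finset.card_eq_sum_card_fiberwise (f := fun p => g p.1) (t := t)
      (s := ((s ×ˢ s).filter fun p => f p.1 = f p.2 ∧ g p.1 = g p.2).filter fun p => f p.1 = k)
      (fun p hp => by simp at hp; exact hg _ hp.1.1.1)]
  simp only [fib']
  exact sq_sum_le_card_mul_sum_sq

/-- The triples `(x, u, n)` with `1 ≤ x, u ≤ N` and `n ∈ Z`. -/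
def triples (N : ℕ) (Z : Finset ℤ) : Finset (ℤ × ℤ × ℤ) :=
  Finset.Icc 1 (N : ℤ) ×ˢ Finset.Icc 1 (N : ℤ) ×ˢ Z

/-- The form `x⁴ - u⁴ - n`. -/
def quarticDiff (t : ℤ × ℤ × ℤ) : ℤ := t.1 ^ 4 - t.2.1 ^ 4 - t.2.2

theorem mem_triples {N : ℕ} {Z : Finset ℤ} {t : ℤ × ℤ × ℤ} : t ∈ triples N Z ↔
    (1 ≤ t.1 ∧ t.1 ≤ N) ∧ (1 ≤ t.2.1 ∧ t.2.1 ≤ N) ∧ t.2.2 ∈ Z := by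
  simp [triples]

theorem card_triples (N : ℕ) (Z : Finset ℤ) : (triples N Z).card = N ^ 2 * Z.card := by
  simp [triples]; ring

/-- Pairs of triples on which `x⁴ - u⁴ - n` and `x - u` both agree. -/
def shiftPairs (N : ℕ) (Z : Finset ℤ) : Finset ((ℤ × ℤ × ℤ) × (ℤ × ℤ × ℤ)) :=
  (triples N Z ×ˢ triples N Z).filter fun p =>
    quarticDiff p.1 = quarticDiff p.2 ∧ p.1.1 - p.1.2.1 = p.2.1 - p.2.2.1

theorem mem_shiftPairs {N : ℕ} {Z : Finset ℤ} {p : (ℤ × ℤ × ℤ) × (ℤ × ℤ × ℤ)} :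
    p ∈ shiftPairs N Z ↔ (p.1 ∈ triples N Z ∧ p.2 ∈ triples N Z) ∧
      quarticDiff p.1 = quarticDiff p.2 ∧ p.1.1 - p.1.2.1 = p.2.1 - p.2.2.1 := by
  simp [shiftPairs]

/-- The nondegenerate members of `shiftPairs`. -/
def nondegPairs (N : ℕ) (Z : Finset ℤ) : Finset ((ℤ × ℤ × ℤ) × (ℤ × ℤ × ℤ)) :=
  (shiftPairs N Z).filter fun p => p.1.1 ≠ p.1.2.1 ∧ p.1.1 ≠ p.2.1

theorem mem_nondegPairs {N : ℕ} {Z : Finset ℤ} {p : (ℤ × ℤ × ℤ) × (ℤ × ℤ × ℤ)} :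
    p ∈ nondegPairs N Z ↔ p ∈ shiftPairs N Z ∧ p.1.1 ≠ p.1.2.1 ∧ p.1.1 ≠ p.2.1 := by
  simp [nondegPairs]

theorem card_shiftPairs_le (N : ℕ) (Z : Finset ℤ) :
    (shiftPairs N Z).card ≤ 2 * (N ^ 2 * Z.card) + (nondegPairs N Z).card := by
  set D₁ := (shiftPairs N Z).filter fun p => p.1.1 = p.1.2.1
  set D₂ := (shiftPairs N Z).filter fun p => p.1.1 = p.2.1
  have h1 : D₁.card ≤ N ^ 2 * Z.card := by
    rw [← card_triples]
    refine Finset.card_le_card_of_injOn (fun p => (p.1.1, p.2.1, p.1.2.2)) ?_ ?_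
    · rintro ⟨⟨x, u, n⟩, y, v, m⟩ hp
      simp only [D₁, mem_shiftPairs, Finset.coe_filter, mem_triples,
        Set.mem_ofPred_eq] at hp
      simp only [Finset.mem_coe, mem_triples]
      tauto
    · rintro ⟨⟨x, u, n⟩, y, v, m⟩ hp ⟨⟨x', u', n'⟩, y', v', m'⟩ hp' heq
      simp only [D₁, mem_shiftPairs, quarticDiff, Finset.coe_filter,
        Set.mem_ofPred_eq, Prod.mk.injEq] at hp hp' heq ⊢
      obtain ⟨⟨-, e1, e2⟩, e3⟩ := hp
      obtain ⟨⟨-, e1', e2'⟩, e3'⟩ := hp'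
      obtain ⟨rfl, rfl, rfl⟩ := heq
      have hv : y = v := by omega
      have hv' : y = v' := by omega
      subst hv hv' e3 e3'
      omega
  have h2 : D₂.card ≤ N ^ 2 * Z.card := by
    rw [← card_triples]
    refine Finset.card_le_card_of_injOn (fun p => p.1) ?_ ?_
    · rintro ⟨⟨x, u, n⟩, y, v, m⟩ hp
      simp only [D₂, mem_shiftPairs, Finset.coe_filter, Set.mem_ofPred_eq] at hp
      exact hp.1.1.1
    · rintro ⟨⟨x, u, n⟩, y, v, m⟩ hp ⟨⟨x', u', n'⟩, y', v', m'⟩ hp' heq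
      simp only [D₂, mem_shiftPairs, quarticDiff, Finset.coe_filter,
        Set.mem_ofPred_eq, Prod.mk.injEq] at hp hp' heq ⊢
      obtain ⟨⟨-, e1, e2⟩, e3⟩ := hp
      obtain ⟨⟨-, e1', e2'⟩, e3'⟩ := hp'
      obtain ⟨rfl, rfl, rfl⟩ := heq
      have hv : u = v := by omega
      have hv' : u = v' := by omega
      subst hv hv' e3 e3'
      omega
  have hsub : shiftPairs N Z ⊆ (D₁ ∪ D₂) ∪ nondegPairs N Z := by
    intro p hp
    simp only [D₁, D₂, nondegPairs, Finset.mem_union, Finset.mem_filter, hp, true_and]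
    tauto
  have := Finset.card_le_card hsub
  have h3 := Finset.card_union_le (D₁ ∪ D₂) (nondegPairs N Z)
  have h4 := Finset.card_union_le D₁ D₂
  omega

/-- Pairs of nondegenerate pairs sharing both shifts and the first element of `Z`. -/
def linkedPairs (N : ℕ) (Z : Finset ℤ) :
    Finset (((ℤ × ℤ × ℤ) × (ℤ × ℤ × ℤ)) × ((ℤ × ℤ × ℤ) × (ℤ × ℤ × ℤ))) :=
  (nondegPairs N Z ×ˢ nondegPairs N Z).filter fun r =>
    (r.1.1.1 - r.1.1.2.1, r.1.1.1 - r.1.2.1, r.1.1.2.2) =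
      (r.2.1.1 - r.2.1.2.1, r.2.1.1 - r.2.2.1, r.2.1.2.2)

theorem card_linkedPairs_le (N D : ℕ) (Z : Finset ℤ)
    (hD : ∀ m ∈ Z, ∀ m' ∈ Z, m ≠ m' → (Int.divisors (m - m')).card ≤ D) :
    (linkedPairs N Z).card ≤ (nondegPairs N Z).card + D ^ 4 * Z.card ^ 2 := by
  set Q := (linkedPairs N Z).filter fun r => r.1 ≠ r.2
  have hdiag : ((linkedPairs N Z).filter fun r => r.1 = r.2).card ≤ (nondegPairs N Z).card := by
    refine Finset.card_le_card_of_injOn (fun r => r.1) ?_ ?_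
    · intro r hr
      simp only [linkedPairs, Finset.coe_filter, Finset.mem_filter, Finset.mem_product,
        Set.mem_ofPred_eq] at hr
      exact hr.1.1.1
    · rintro ⟨a, b⟩ hr ⟨a', b'⟩ hr' heq
      simp only [Finset.coe_filter, Set.mem_ofPred_eq] at hr hr' heq
      rw [← hr.2, ← hr'.2, heq]
  -- the key factorisation
  have key : ∀ r ∈ Q, r.1.2.2.2 ∈ Z ∧ r.2.2.2.2 ∈ Z ∧ r.1.2.2.2 ≠ r.2.2.2.2 ∧
      r.1.2.2.2 - r.2.2.2.2 = 3 * (r.1.1.1 - r.1.1.2.1) * (r.1.1.1 - r.1.2.1) *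
        ((r.2.1.2.1 + r.2.2.1) - (r.1.1.2.1 + r.1.2.1)) *
        ((r.2.1.2.1 + r.2.2.1) + (r.1.1.2.1 + r.1.2.1)) := by
    rintro ⟨⟨⟨x, u, n⟩, y, v, m⟩, ⟨x', u', n'⟩, y', v', m'⟩ hr
    simp only [Q, linkedPairs, mem_nondegPairs, mem_shiftPairs, quarticDiff, mem_triples,
      Finset.mem_filter, Finset.mem_product, Prod.mk.injEq, ne_eq] at hr ⊢
    obtain ⟨⟨⟨⟨⟨⟨hA, hB⟩, e1, e2⟩, hxu, hxy⟩, ⟨⟨hA', hB'⟩, e1', e2'⟩, hxu', hxy'⟩, k1, k2, k3⟩,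
      hne⟩ := hr
    have hfac : m - m' = 3 * (x - u) * (x - y) * ((u' + y') - (u + y)) * ((u' + y') + (u + y)) := by
      obtain ⟨a, ha⟩ : ∃ a, a = x - u := ⟨_, rfl⟩
      obtain ⟨b, hb⟩ : ∃ b, b = x - y := ⟨_, rfl⟩
      have q1 : x = v + a + b := by omega
      have q2 : u = v + b := by omega
      have q3 : y = v + a := by omega
      have q1' : x' = v' + a + b := by omega
      have q2' : u' = v' + b := by omega
      have q3' : y' = v' + a := by omega
      have s1 : m = n + y ^ 4 - v ^ 4 - x ^ 4 + u ^ 4 := by linarith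
      have s2 : m' = n + y' ^ 4 - v' ^ 4 - x' ^ 4 + u' ^ 4 := by rw [k3]; linarith
      rw [s1, s2, q1, q2, q3, q1', q2', q3']
      ring
    refine ⟨hB.2.2, hB'.2.2, ?_, hfac⟩
    intro hmm
    have h0 : 3 * (x - u) * (x - y) * ((u' + y') - (u + y)) * ((u' + y') + (u + y)) = 0 := by
      rw [← hfac, hmm, sub_self]
    have n1 : x - u ≠ 0 := sub_ne_zero.mpr hxu
    have n2 : x - y ≠ 0 := sub_ne_zero.mpr hxy
    have n3 : (u' + y') + (u + y) ≠ 0 := by omega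
    have n4 : (u' + y') - (u + y) = 0 := by
      simpa [n1, n2, n3] using h0
    apply hne
    omega
  have hQ : Q.card ≤ D ^ 4 * Z.card ^ 2 := by
    have hmap : ∀ r ∈ Q, (r.1.2.2.2, r.2.2.2.2) ∈ Z.offDiag := by
      intro r hr
      obtain ⟨h1, h2, h3, -⟩ := key r hr
      simp [h1, h2, h3]
    refine (Finset.card_le_mul_card_image_of_maps_to hmap (D ^ 4) ?_).trans ?_
    · rintro ⟨m, m'⟩ hm
      simp only [Finset.mem_offDiag] at hm
      set V := Int.divisors (m - m')
      have hV : (V ×ˢ V ×ˢ V ×ˢ V).card ≤ D ^ 4 := by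
        simp only [Finset.card_product]
        calc V.card * (V.card * (V.card * V.card)) = V.card ^ 4 := by ring
          _ ≤ D ^ 4 := Nat.pow_le_pow_left (hD m hm.1 m' hm.2.1 hm.2.2) 4
      refine le_trans (Finset.card_le_card_of_injOn (fun r =>
        (r.1.1.1 - r.1.1.2.1, r.1.1.1 - r.1.2.1,
          (r.2.1.2.1 + r.2.2.1) - (r.1.1.2.1 + r.1.2.1),
          (r.2.1.2.1 + r.2.2.1) + (r.1.1.2.1 + r.1.2.1))) ?_ ?_) hV
      · intro r hr
        obtain ⟨hrQ, hrm⟩ := Finset.mem_filter.mp (Finset.mem_coe.mp hr)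
        obtain ⟨-, -, h3, h4⟩ := key r hrQ
        simp only [Prod.mk.injEq] at hrm
        rw [hrm.1, hrm.2] at h4
        have hne : m - m' ≠ 0 := sub_ne_zero.mpr hm.2.2
        simp only [Finset.coe_product, Set.mem_prod, Finset.mem_coe, V, Int.mem_divisors, h4]
        rw [h4] at hne
        refine ⟨⟨⟨3 * (r.1.1.1 - r.1.2.1) * ((r.2.1.2.1 + r.2.2.1) - (r.1.1.2.1 + r.1.2.1)) *
            ((r.2.1.2.1 + r.2.2.1) + (r.1.1.2.1 + r.1.2.1)), by ring⟩, hne⟩,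
          ⟨⟨3 * (r.1.1.1 - r.1.1.2.1) * ((r.2.1.2.1 + r.2.2.1) - (r.1.1.2.1 + r.1.2.1)) *
            ((r.2.1.2.1 + r.2.2.1) + (r.1.1.2.1 + r.1.2.1)), by ring⟩, hne⟩,
          ⟨⟨3 * (r.1.1.1 - r.1.1.2.1) * (r.1.1.1 - r.1.2.1) *
            ((r.2.1.2.1 + r.2.2.1) + (r.1.1.2.1 + r.1.2.1)), by ring⟩, hne⟩,
          ⟨Dvd.intro_left _ rfl, hne⟩⟩
      · rintro ⟨⟨⟨x, u, n⟩, y, v, m₁⟩, ⟨x', u', n'⟩, y', v', m₁'⟩ hr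
          ⟨⟨⟨X, U, N₁⟩, Y, W, M₁⟩, ⟨X', U', N₁'⟩, Y', W', M₁'⟩ hR heq
        simp only [Q, linkedPairs, mem_nondegPairs, mem_shiftPairs, quarticDiff,
          Finset.mem_filter, Finset.coe_filter, Set.mem_ofPred_eq, Finset.mem_product,
          Prod.mk.injEq] at hr hR heq ⊢
        obtain ⟨⟨⟨⟨⟨⟨-, e1, e2⟩, -⟩, ⟨-, e1', e2'⟩, -⟩, k1, k2, k3⟩, -⟩, rfl, rfl⟩ := hr
        obtain ⟨⟨⟨⟨⟨⟨-, E1, E2⟩, -⟩, ⟨-, E1', E2'⟩, -⟩, K1, K2, K3⟩, -⟩, rfl, rfl⟩ := hR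
        obtain ⟨a1, a2, a3, a4⟩ := heq
        have b1 : x = X := by omega
        have b2 : u = U := by omega
        have b3 : y = Y := by omega
        have b4 : v = W := by omega
        have b5 : x' = X' := by omega
        have b6 : u' = U' := by omega
        have b7 : y' = Y' := by omega
        have b8 : v' = W' := by omega
        subst b1 b2 b3 b4 b5 b6 b7 b8
        omega
    · gcongr
      rw [Finset.offDiag_card, sq]
      exact Nat.sub_le _ _
  have := Finset.card_filter_add_card_filter_not (s := linkedPairs N Z) (fun r => r.1 = r.2)
  change _ + Q.card = _ at this
  omega

theorem card_nondegPairs_sq_le (N : ℕ) (hN : 1 ≤ N) (Z : Finset ℤ) :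
    (nondegPairs N Z).card ^ 2 ≤ 9 * N ^ 2 * Z.card * (linkedPairs N Z).card := by
  set I := Finset.Icc (-(N : ℤ)) N
  have hI : I.card ≤ 3 * N := by simp only [I, Int.card_Icc]; omega
  have h := card_filter_eq_le_card_mul (nondegPairs N Z) (fun _ => ())
    (fun p => (p.1.1 - p.1.2.1, p.1.1 - p.2.1, p.1.2.2)) (I ×ˢ I ×ˢ Z) (by
      rintro ⟨⟨x, u, n⟩, y, v, m⟩ hp
      simp only [mem_nondegPairs, mem_shiftPairs, mem_triples] at hp
      simp only [I, Finset.mem_product, Finset.mem_Icc]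
      refine ⟨by omega, by omega, hp.1.1.1.2.2⟩)
  simp only [Finset.filter_true, true_and, Finset.card_product] at h
  rw [sq]
  refine h.trans ?_
  calc _ ≤ 3 * N * (3 * N * Z.card) * (linkedPairs N Z).card := by
        unfold linkedPairs; gcongr
    _ = _ := by ring

theorem card_quarticDiff_eq_le (N D : ℕ) (hN : 1 ≤ N) (Z : Finset ℤ)
    (hD : ∀ m ∈ Z, ∀ m' ∈ Z, m ≠ m' → (Int.divisors (m - m')).card ≤ D) :
    (((triples N Z ×ˢ triples N Z).filter
      fun p => quarticDiff p.1 = quarticDiff p.2).card : ℝ) ≤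
    33 * ((N : ℝ) ^ 3 * Z.card) + 9 * ((N : ℝ) ^ 2 * (D : ℝ) ^ 2 * (Z.card : ℝ) ^ ((3 : ℝ) / 2)) := by
  set I := Finset.Icc (-(N : ℤ)) N
  have hI : I.card ≤ 3 * N := by simp only [I, Int.card_Icc]; omega
  have h0 := card_filter_eq_le_card_mul (triples N Z) quarticDiff
    (fun t => t.1 - t.2.1) I (by
      rintro ⟨x, u, n⟩ hp
      simp only [mem_triples] at hp
      simp only [I, Finset.mem_Icc]
      omega)
  have h1 : (((triples N Z ×ˢ triples N Z).filter
      fun p => quarticDiff p.1 = quarticDiff p.2).card : ℝ) ≤ 3 * N * (shiftPairs N Z).card := by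
    exact_mod_cast h0.trans (Nat.mul_le_mul_right _ hI)
  have h2 : ((shiftPairs N Z).card : ℝ) ≤ 2 * (N ^ 2 * Z.card) + (nondegPairs N Z).card := by
    exact_mod_cast card_shiftPairs_le N Z
  have h3 : ((nondegPairs N Z).card : ℝ) ^ 2 ≤ 9 * N ^ 2 * Z.card * (linkedPairs N Z).card := by
    exact_mod_cast card_nondegPairs_sq_le N hN Z
  have h4 : ((linkedPairs N Z).card : ℝ) ≤ (nondegPairs N Z).card + D ^ 4 * Z.card ^ 2 := by
    exact_mod_cast card_linkedPairs_le N D Z hD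
  set S : ℝ := ((nondegPairs N Z).card : ℝ)
  set L : ℝ := ((linkedPairs N Z).card : ℝ)
  set z : ℝ := (Z.card : ℝ) with hz
  have hz0 : 0 ≤ z := Nat.cast_nonneg _
  have hS0 : 0 ≤ S := Nat.cast_nonneg _
  set n : ℝ := (N : ℝ)
  have hn0 : 0 ≤ n := Nat.cast_nonneg _
  set w : ℝ := z ^ ((3 : ℝ) / 2) with hw
  have hw2 : w ^ 2 = z ^ 3 := by
    rw [hw, ← Real.rpow_natCast, ← Real.rpow_mul hz0, ← Real.rpow_natCast]; norm_num
  have hw0 : 0 ≤ w := Real.rpow_nonneg hz0 _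
  set d : ℝ := (D : ℝ)
  have h5 : S ^ 2 ≤ 9 * n ^ 2 * z * S + (3 * n * d ^ 2 * w) ^ 2 := by
    calc S ^ 2 ≤ 9 * n ^ 2 * z * (S + d ^ 4 * z ^ 2) := h3.trans (by gcongr)
      _ = 9 * n ^ 2 * z * S + 9 * n ^ 2 * d ^ 4 * z ^ 3 := by ring
      _ = _ := by rw [← hw2]; ring
  have h6 : S ≤ 9 * n ^ 2 * z + 3 * n * d ^ 2 * w := by
    have ha : 0 ≤ 9 * n ^ 2 * z := by positivity
    have hb : 0 ≤ 3 * n * d ^ 2 * w := by positivity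
    by_contra! hlt
    nlinarith
  calc _ ≤ 3 * n * (2 * (n ^ 2 * z) + (9 * n ^ 2 * z + 3 * n * d ^ 2 * w)) :=
        h1.trans (by gcongr; linarith)
    _ = _ := by ring

theorem norm_e (z : ℝ) : ‖e z‖ = 1 := by
  have : (2 * Real.pi * Complex.I * z : ℂ) = ((2 * Real.pi * z : ℝ) : ℂ) * Complex.I := by
    push_cast; ring
  rw [e, this, Complex.norm_exp_ofReal_mul_I]

theorem e_add (a b : ℝ) : e (a + b) = e a * e b := by
  rw [e, e, e, ← Complex.exp_add]; push_cast; ring_nf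

theorem conj_e (z : ℝ) : (starRingEnd ℂ) (e z) = e (-z) := by
  rw [e, e, ← Complex.exp_conj]
  simp only [map_mul, Complex.conj_ofReal, Complex.conj_I, map_ofNat]
  push_cast; ring_nf

theorem e_intCast (k : ℤ) : e k = 1 := by
  rw [e, Complex.exp_eq_one_iff]; exact ⟨k, by push_cast; ring⟩

@[fun_prop]
theorem continuous_e : Continuous e := by unfold e; fun_prop

theorem integral_e_intCast_mul (k : ℤ) :
    ∫ α in (0 : ℝ)..1, e (k * α) = if k = 0 then 1 else 0 := by
  split_ifs with hk
  · simp [hk, e]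
  · have hc : (2 * Real.pi * Complex.I * k : ℂ) ≠ 0 := by
      simp [hk, Complex.I_ne_zero, Real.pi_ne_zero]
    have hfun : ∀ α : ℝ, e (k * α) = Complex.exp ((2 * Real.pi * Complex.I * k) * α) := by
      intro α; rw [e]; push_cast; ring_nf
    simp only [hfun]
    rw [integral_exp_mul_complex hc]
    have := e_intCast k
    rw [e] at this
    push_cast at this
    simp [this]

/-- The mean square of a trigonometric sum with coefficients bounded by `1` is at most the number
of coincidences among its frequencies. -/
theorem integral_norm_sq_le_card {ι : Type*} (s : Finset ι) (f : ι → ℤ) (c : ι → ℂ)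
    (hc : ∀ i ∈ s, ‖c i‖ ≤ 1) :
    ∫ α in (0 : ℝ)..1, ‖∑ i ∈ s, c i * e (f i * α)‖ ^ 2 ≤
      (((s ×ˢ s).filter fun p => f p.1 = f p.2).card : ℝ) := by
  have hexp : ∀ α : ℝ, ((‖∑ i ∈ s, c i * e (f i * α)‖ ^ 2 : ℝ) : ℂ) =
      ∑ p ∈ s ×ˢ s, c p.1 * (starRingEnd ℂ) (c p.2) * e (((f p.1 - f p.2 : ℤ) : ℝ) * α) := by
    intro α
    push_cast
    rw [← Complex.mul_conj', map_sum, Finset.sum_mul_sum, Finset.sum_product]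
    refine Finset.sum_congr rfl fun i _ => Finset.sum_congr rfl fun j _ => ?_
    rw [map_mul, conj_e, sub_mul, sub_eq_add_neg, e_add]
    ring
  have hint : ((∫ α in (0 : ℝ)..1, ‖∑ i ∈ s, c i * e (f i * α)‖ ^ 2 : ℝ) : ℂ) =
      ∑ p ∈ (s ×ˢ s).filter fun p => f p.1 = f p.2, c p.1 * (starRingEnd ℂ) (c p.2) := by
    rw [← intervalIntegral.integral_ofReal]
    simp only [hexp]
    rw [intervalIntegral.integral_finsetSum
      (fun p _ => Continuous.intervalIntegrable (by fun_prop) _ _), Finset.sum_filter]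
    refine Finset.sum_congr rfl fun p _ => ?_
    rw [intervalIntegral.integral_const_mul, integral_e_intCast_mul]
    simp [sub_eq_zero]
  calc _ ≤ ‖((∫ α in (0 : ℝ)..1, ‖∑ i ∈ s, c i * e (f i * α)‖ ^ 2 : ℝ) : ℂ)‖ := by
        rw [Complex.norm_real]; exact le_abs_self _
    _ ≤ ∑ p ∈ (s ×ˢ s).filter fun p => f p.1 = f p.2, (1 : ℝ) := by
        rw [hint]
        refine (norm_sum_le _ _).trans (Finset.sum_le_sum fun p hp => ?_)
        simp only [Finset.mem_filter, Finset.mem_product] at hp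
        rw [norm_mul, RCLike.norm_conj]
        exact mul_le_one₀ (hc _ hp.1.1) (norm_nonneg _) (hc _ hp.1.2)
    _ = _ := by simp

theorem sq_integral_mul_le (f g : ℝ → ℝ) (hf : Continuous f) (hg : Continuous g) :
    (∫ α in (0 : ℝ)..1, f α * g α) ^ 2 ≤
      (∫ α in (0 : ℝ)..1, f α ^ 2) * ∫ α in (0 : ℝ)..1, g α ^ 2 := by
  have h := discrim_le_zero (a := ∫ α in (0 : ℝ)..1, f α ^ 2)
    (b := 2 * ∫ α in (0 : ℝ)..1, f α * g α) (c := ∫ α in (0 : ℝ)..1, g α ^ 2) (by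
      intro t
      have hnn : 0 ≤ ∫ α in (0 : ℝ)..1, (f α * t + g α) ^ 2 :=
        intervalIntegral.integral_nonneg zero_le_one fun α _ => sq_nonneg _
      have heq : ∀ α, (f α * t + g α) ^ 2 =
          (t * t) * f α ^ 2 + (2 * t) * (f α * g α) + g α ^ 2 := fun α => by ring
      simp only [heq] at hnn
      rw [intervalIntegral.integral_add (Continuous.intervalIntegrable (by fun_prop) _ _)
          (Continuous.intervalIntegrable (by fun_prop) _ _),
        intervalIntegral.integral_add (Continuous.intervalIntegrable (by fun_prop) _ _)
          (Continuous.intervalIntegrable (by fun_prop) _ _),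
        intervalIntegral.integral_const_mul, intervalIntegral.integral_const_mul] at hnn
      linarith)
  rw [discrim] at h
  linarith

@[fun_prop]
theorem continuous_h (P R : ℝ) : Continuous (h P R) := by unfold h; fun_prop

@[fun_prop]
theorem continuous_K (P R T : ℝ) : Continuous (K P R T) := by unfold K; fun_prop

theorem norm_h_one_sub (P R α : ℝ) : ‖h P R (1 - α)‖ = ‖h P R α‖ := by
  rw [← RCLike.norm_conj (h P R α)]
  congr 1
  rw [h, h, map_sum]
  refine Finset.sum_congr rfl fun x _ => ?_
  rw [conj_e, sub_mul, sub_eq_add_neg, e_add]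
  have := e_intCast ((x : ℤ) ^ 4)
  push_cast at this
  rw [one_mul, this, one_mul]

theorem conj_ψ (P R : ℝ) (n : ℤ) : (starRingEnd ℂ) (ψ P R n) = ψ P R n := by
  have h1 : (starRingEnd ℂ) (ψ P R n) =
      ∫ α in (0 : ℝ)..1, (‖h P R α‖ : ℂ) ^ 7 * e ((n : ℝ) * α) := by
    rw [ψ, ← intervalIntegral.intervalIntegral_conj]
    simp only [map_mul, map_pow, Complex.conj_ofReal, conj_e]
    congr 1; ext α; ring_nf
  have h2 := intervalIntegral.integral_comp_sub_left (a := 0) (b := 1)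
    (fun α : ℝ => (‖h P R α‖ : ℂ) ^ 7 * e ((n : ℝ) * α)) 1
  rw [sub_self, sub_zero] at h2
  rw [h1, ← h2, ψ]
  congr 1; ext α
  have h3 : (n : ℝ) * (1 - α) = n + -(n : ℝ) * α := by ring
  rw [norm_h_one_sub, h3, e_add, e_intCast, one_mul]

theorem sign_mul_ψ (P R : ℝ) (n : ℤ) :
    (if 0 < (ψ P R n).re then (1 : ℂ) else -1) * ψ P R n = (‖ψ P R n‖ : ℂ) := by
  obtain ⟨r, hr⟩ := Complex.conj_eq_iff_real.mp (conj_ψ P R n)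
  rw [hr, Complex.ofReal_re, Complex.norm_real, Real.norm_eq_abs]
  split_ifs with h0
  · rw [abs_of_pos h0, one_mul]
  · rw [abs_of_nonpos (not_lt.mp h0)]; push_cast; ring

theorem mul_card_Zset_le (P R T : ℝ) :
    T * (Zset P R T).card ≤ ∫ α in (0 : ℝ)..1, ‖h P R α‖ ^ 7 * ‖K P R T α‖ := by
  have hsum : ((∑ n ∈ Zset P R T, ‖ψ P R n‖ : ℝ) : ℂ) =
      ∫ α in (0 : ℝ)..1, (‖h P R α‖ : ℂ) ^ 7 * K P R T α := by
    simp only [K, Finset.mul_sum]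
    rw [intervalIntegral.integral_finsetSum
      (fun p _ => Continuous.intervalIntegrable (by fun_prop) _ _)]
    push_cast
    refine Finset.sum_congr rfl fun n _ => ?_
    rw [← sign_mul_ψ, ψ, ← intervalIntegral.integral_const_mul]
    congr 1; ext α; ring
  calc T * (Zset P R T).card = ∑ n ∈ Zset P R T, T := by simp [mul_comm]
    _ ≤ ∑ n ∈ Zset P R T, ‖ψ P R n‖ :=
        Finset.sum_le_sum fun n hn => (Finset.mem_filter.mp hn).2.1.le
    _ ≤ ‖((∑ n ∈ Zset P R T, ‖ψ P R n‖ : ℝ) : ℂ)‖ := by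
        rw [Complex.norm_real]; exact le_abs_self _
    _ ≤ ∫ α in (0 : ℝ)..1, ‖(‖h P R α‖ : ℂ) ^ 7 * K P R T α‖ := by
        rw [hsum]; exact intervalIntegral.norm_integral_le_integral_norm zero_le_one
    _ = _ := by simp

theorem sq_mul_card_Zset_le (P R T : ℝ) (hT : 1 ≤ T) :
    (T * (Zset P R T).card) ^ 2 ≤ (∫ α in (0 : ℝ)..1, ‖h P R α‖ ^ 10) *
      ∫ α in (0 : ℝ)..1, ‖(h P R α) ^ 4 * (K P R T α) ^ 2‖ := by
  have h1 := sq_integral_mul_le (fun α => ‖h P R α‖ ^ 5) (fun α => ‖h P R α‖ ^ 2 * ‖K P R T α‖)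
    (by fun_prop) (by fun_prop)
  have e1 : ∀ α, ‖h P R α‖ ^ 5 * (‖h P R α‖ ^ 2 * ‖K P R T α‖) =
    ‖h P R α‖ ^ 7 * ‖K P R T α‖ := fun α => by ring
  have e2 : ∀ α, (‖h P R α‖ ^ 5) ^ 2 = ‖h P R α‖ ^ 10 := fun α => by ring
  have e3 : ∀ α, (‖h P R α‖ ^ 2 * ‖K P R T α‖) ^ 2 = ‖(h P R α) ^ 4 * (K P R T α) ^ 2‖ :=
    fun α => by rw [norm_mul, norm_pow, norm_pow]; ring
  simp only [e1, e2, e3] at h1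
  exact (pow_le_pow_left₀ (by positivity) (mul_card_Zset_le P R T) 2).trans h1

theorem integral_le_card_quarticDiff (P R T : ℝ) :
    ∫ α in (0 : ℝ)..1, ‖(h P R α) ^ 4 * (K P R T α) ^ 2‖ ≤
      (((triples ⌊P⌋₊ (Zset P R T) ×ˢ triples ⌊P⌋₊ (Zset P R T)).filter
        fun p => quarticDiff p.1 = quarticDiff p.2).card : ℝ) := by
  let ω : ℤ → ℂ := fun n => if 0 < (ψ P R n).re then (1 : ℂ) else -1
  let cast : ℕ × ℕ × ℤ → ℤ × ℤ × ℤ := fun t => (t.1, t.2.1, t.2.2)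
  have hcast : Function.Injective cast := by
    rintro ⟨x, u, n⟩ ⟨y, v, m⟩ hxy
    simpa [cast] using hxy
  let s := smoothA P R ×ˢ smoothA P R ×ˢ Zset P R T
  have hrw : ∀ α : ℝ, ‖(h P R α) ^ 4 * (K P R T α) ^ 2‖ =
      ‖∑ t ∈ s, ω t.2.2 * e ((quarticDiff (cast t) : ℤ) * α)‖ ^ 2 := by
    intro α
    have h1 : ∑ t ∈ s, ω t.2.2 * e ((quarticDiff (cast t) : ℤ) * α) =
        h P R α * ((starRingEnd ℂ) (h P R α) * K P R T α) := by
      rw [h, K, map_sum, Finset.sum_mul_sum, Finset.sum_mul_sum, Finset.sum_product]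
      refine Finset.sum_congr rfl fun x _ => ?_
      rw [Finset.sum_product, ← Finset.mul_sum, Finset.mul_sum]
      refine Finset.sum_congr rfl fun u _ => ?_
      rw [Finset.mul_sum]
      refine Finset.sum_congr rfl fun n _ => ?_
      have h2 : ((quarticDiff (cast (x, u, n)) : ℤ) : ℝ) * α =
          α * (x : ℝ) ^ 4 + (-(α * (u : ℝ) ^ 4) + -(n : ℝ) * α) := by
        simp only [quarticDiff, cast]; push_cast; ring
      rw [h2, e_add, e_add, conj_e]
      ring
    rw [h1, norm_mul, norm_mul, norm_mul, norm_pow, norm_pow, RCLike.norm_conj]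
    ring
  simp only [hrw]
  refine (integral_norm_sq_le_card s (fun t => quarticDiff (cast t)) (fun t => ω t.2.2) ?_).trans ?_
  · intro t _
    simp only [ω]
    split_ifs <;> simp
  · norm_cast
    refine Finset.card_le_card_of_injOn (Prod.map cast cast) ?_ (hcast.prodMap hcast).injOn
    have hmem : ∀ t ∈ s, cast t ∈ triples ⌊P⌋₊ (Zset P R T) := by
      rintro ⟨x, u, n⟩ ht
      simp only [s, smoothA, Finset.mem_product, Finset.mem_filter, Finset.mem_Icc] at ht
      simp only [mem_triples, cast]
      refine ⟨?_, ?_, ht.2.2⟩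
      · exact_mod_cast ht.1.1
      · exact_mod_cast ht.2.1.1
    rintro ⟨a, b⟩ hp
    simp only [Finset.coe_filter, Finset.mem_product, Set.mem_ofPred_eq] at hp
    simp only [Finset.coe_filter, Finset.mem_product, Set.mem_ofPred_eq, Prod.map]
    exact ⟨⟨hmem _ hp.1.1, hmem _ hp.1.2⟩, hp.2⟩

theorem card_int_divisors (z : ℤ) : (Int.divisors z).card = 2 * z.natAbs.divisors.card := by
  rw [Int.divisors, Finset.card_disjUnion, Finset.card_map, Finset.card_map, two_mul]

/-- A mean value estimate valid with any exponent `η > 0`. -/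
theorem integral_h_pow_four_mul_K_sq_le {η : ℝ} (hη : 0 < η) :
    ∃ B : ℝ, 0 < B ∧ ∀ P R T : ℝ, 2 ≤ P →
      ∫ α in (0 : ℝ)..1, ‖(h P R α) ^ 4 * (K P R T α) ^ 2‖ ≤
        B * (P ^ 3 * ((Zset P R T).card : ℝ) +
          P ^ ((2 : ℝ) + η) * ((Zset P R T).card : ℝ) ^ ((3 : ℝ) / 2)) := by
  obtain ⟨C, hC1, hC⟩ := card_divisors_le_rpow (δ := η / 20) (by positivity)
  refine ⟨33 + 36 * C ^ 2, by positivity, fun P R T hP => ?_⟩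
  have hP0 : 0 < P := by linarith
  set Z := Zset P R T
  set N := ⌊P⌋₊
  have hN1 : 1 ≤ N := Nat.le_floor (by push_cast; linarith)
  have hNP : (N : ℝ) ≤ P := Nat.floor_le hP0.le
  set E : ℝ := 2 * (C * P ^ (η / 2)) with hE
  have hE0 : 0 ≤ E := by positivity
  have hD : ∀ m ∈ Z, ∀ m' ∈ Z, m ≠ m' → (Int.divisors (m - m')).card ≤ ⌊E⌋₊ := by
    intro m hm m' hm' hne
    refine Nat.le_floor ?_
    rw [card_int_divisors]
    push_cast
    rw [hE]
    gcongr
    refine (hC _ (by omega)).trans ?_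
    have hb : ∀ k ∈ Z, |(k : ℝ)| ≤ P ^ 9 := by
      intro k hk
      have hk' := Finset.mem_Icc.mp (Finset.mem_filter.mp hk).1
      have h1 : ((⌊P ^ 9⌋ : ℤ) : ℝ) ≤ P ^ 9 := Int.floor_le _
      have h2 : (-(⌊P ^ 9⌋ : ℤ) : ℝ) ≤ k := by exact_mod_cast hk'.1
      have h3 : (k : ℝ) ≤ (⌊P ^ 9⌋ : ℤ) := by exact_mod_cast hk'.2
      exact abs_le.mpr ⟨by linarith, by linarith⟩
    have hle : (((m - m').natAbs : ℕ) : ℝ) ≤ P ^ 10 := by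
      rw [Nat.cast_natAbs]
      push_cast
      have h9 : 0 < P ^ 9 := by positivity
      calc |(m : ℝ) - m'| ≤ |(m : ℝ)| + |(m' : ℝ)| := abs_sub _ _
        _ ≤ P ^ 9 + P ^ 9 := add_le_add (hb m hm) (hb m' hm')
        _ ≤ P ^ 10 := by nlinarith
    calc _ ≤ C * (P ^ 10) ^ (η / 20) := by gcongr
      _ = C * P ^ (η / 2) := by
        rw [← Real.rpow_natCast, ← Real.rpow_mul hP0.le]
        congr 2; push_cast; ring
  have hcount := card_quarticDiff_eq_le N ⌊E⌋₊ hN1 Z hD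
  have hfl : ((⌊E⌋₊ : ℕ) : ℝ) ^ 2 ≤ 4 * C ^ 2 * P ^ η := by
    calc ((⌊E⌋₊ : ℕ) : ℝ) ^ 2 ≤ E ^ 2 := by gcongr; exact Nat.floor_le hE0
      _ = 4 * C ^ 2 * (P ^ (η / 2)) ^ 2 := by rw [hE]; ring
      _ = _ := by
        rw [← Real.rpow_natCast (P ^ (η / 2)), ← Real.rpow_mul hP0.le]
        congr 2; push_cast; ring
  have hsplit : P ^ ((2 : ℝ) + η) = P ^ 2 * P ^ η := by
    rw [Real.rpow_add hP0]; norm_cast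
  refine (integral_le_card_quarticDiff P R T).trans (hcount.trans ?_)
  have hw : 0 ≤ (Z.card : ℝ) ^ ((3 : ℝ) / 2) := by positivity
  have hPη : 0 ≤ P ^ η := by positivity
  calc _ ≤ 33 * (P ^ 3 * Z.card) +
        9 * (P ^ 2 * (4 * C ^ 2 * P ^ η) * (Z.card : ℝ) ^ ((3 : ℝ) / 2)) := by gcongr
    _ ≤ _ := by
        rw [hsplit]
        have a1 : 0 ≤ 36 * C ^ 2 * (P ^ 3 * (Z.card : ℝ)) := by positivity
        have a2 : 0 ≤ P ^ 2 * P ^ η * (Z.card : ℝ) ^ ((3 : ℝ) / 2) := by positivity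
        nlinarith

/-- second large-values estimate for `Z = card 𝒵`:
`Z ≪ P^{9 + Δ₁₀}·T⁻² + P^{16 + 2Δ₁₀ + ε}·T⁻⁴`. -/
theorem large_values_second_estimate
    (ε C₁ C₃ : ℝ) (hε : 0 < ε) (hC₁ : 0 < C₁) (hC₃ : 0 < C₃) :
    ∃ C : ℝ, ∀ P R T : ℝ, 2 ≤ P → 2 ≤ R → R ≤ P → 1 ≤ T →
      (∫ α in (0:ℝ)..1, ‖h P R α‖ ^ 10) ≤ C₁ * P ^ ((6:ℝ) + Δ₁₀) →
      (∫ α in (0:ℝ)..1, ‖(h P R α) ^ 4 * (K P R T α) ^ 2‖) ≤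
          C₃ * (P ^ 3 * ((Zset P R T).card : ℝ) +
            P ^ ((2:ℝ) + ε) * ((Zset P R T).card : ℝ) ^ ((3:ℝ)/2)) →
      ((Zset P R T).card : ℝ) ≤
        C * (P ^ ((9:ℝ) + Δ₁₀) / T ^ 2 + P ^ (16 + 2 * Δ₁₀ + ε) / T ^ 4) := by
  -- The hypothesis at `ε` would only give `P ^ (16 + 2Δ₁₀ + 2ε)`, so the mean value is
  -- estimated with `ε / 2` instead.
  obtain ⟨B, hB, hmean⟩ := integral_h_pow_four_mul_K_sq_le (half_pos hε)
  set A : ℝ := C₁ * B with hA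
  have hA0 : 0 < A := mul_pos hC₁ hB
  refine ⟨2 * A + A ^ 2, fun P R T hP _ _ hT h10 _ => ?_⟩
  have hP0 : 0 < P := by linarith
  have hT0 : 0 < T := by linarith
  have hZ := sq_mul_card_Zset_le P R T hT
  have hM := hmean P R T hP
  set z : ℝ := ((Zset P R T).card : ℝ)
  have hz0 : 0 ≤ z := Nat.cast_nonneg _
  set X : ℝ := P ^ ((9 : ℝ) + Δ₁₀) with hX
  set Y : ℝ := P ^ ((8 : ℝ) + Δ₁₀ + ε / 2) with hY
  have hX0 : 0 < X := Real.rpow_pos_of_pos hP0 _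
  have hY0 : 0 < Y := Real.rpow_pos_of_pos hP0 _
  have hY2 : P ^ (16 + 2 * Δ₁₀ + ε) = Y ^ 2 := by
    rw [hY, ← Real.rpow_natCast, ← Real.rpow_mul hP0.le]; congr 1; push_cast; ring
  have hXe : P ^ ((6 : ℝ) + Δ₁₀) * P ^ 3 = X := by
    rw [hX, ← Real.rpow_natCast, ← Real.rpow_add hP0]; congr 1; push_cast; ring
  have hYe : P ^ ((6 : ℝ) + Δ₁₀) * P ^ ((2 : ℝ) + ε / 2) = Y := by
    rw [hY, ← Real.rpow_add hP0]; congr 1; ring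
  set s : ℝ := √z
  have hs0 : 0 ≤ s := Real.sqrt_nonneg _
  have hsz : s ^ 2 = z := Real.sq_sqrt hz0
  have hs3 : z ^ ((3 : ℝ) / 2) = s ^ 3 := by
    rw [← hsz, ← Real.rpow_natCast, ← Real.rpow_natCast, ← Real.rpow_mul hs0]; norm_num
  have hmain : T ^ 2 * s ^ 4 ≤ A * (X * s ^ 2 + Y * s ^ 3) := by
    calc T ^ 2 * s ^ 4 = (T * z) ^ 2 := by rw [← hsz]; ring
      _ ≤ (C₁ * P ^ ((6 : ℝ) + Δ₁₀)) * (B * (P ^ 3 * z + P ^ ((2 : ℝ) + ε / 2) *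
            z ^ ((3 : ℝ) / 2))) :=
          hZ.trans (mul_le_mul h10 hM
            (intervalIntegral.integral_nonneg zero_le_one fun α _ => norm_nonneg _)
            (by positivity))
      _ = A * (X * s ^ 2 + Y * s ^ 3) := by rw [hs3, ← hXe, ← hYe, hA, ← hsz]; ring
  rw [hY2, ← hsz]
  have hquad : T ^ 4 * s ^ 2 ≤ 2 * A * X * T ^ 2 + A ^ 2 * Y ^ 2 := by
    rcases hs0.eq_or_lt with h0 | hpos
    · rw [← h0]; simp; positivity
    · have h1 : T ^ 2 * s ^ 2 ≤ A * (X + Y * s) := by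
        refine le_of_mul_le_mul_right ?_ (pow_pos hpos 2)
        linarith
      have h2 := mul_le_mul_of_nonneg_right h1 (sq_nonneg T)
      nlinarith [sq_nonneg (T ^ 2 * s - A * Y)]
  have hfinal : s ^ 2 ≤ (2 * A * X * T ^ 2 + A ^ 2 * Y ^ 2) / T ^ 4 := by
    rw [le_div_iff₀ (by positivity)]; linarith
  refine hfinal.trans ?_
  have hsplit : (2 * A * X * T ^ 2 + A ^ 2 * Y ^ 2) / T ^ 4 =
      2 * A * (X / T ^ 2) + A ^ 2 * (Y ^ 2 / T ^ 4) := by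
    field_simp
  rw [hsplit]
  have p1 : 0 ≤ A ^ 2 * (X / T ^ 2) := by positivity
  have p2 : 0 ≤ 2 * A * (Y ^ 2 / T ^ 4) := by positivity
  linarith
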